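/- Let Z be a finite nonempty set, Θ an arbitrary parameter type, p : Θ → Z → ℝ with p(θ)(z) > 0 for all θ, z, and P : Θ → ℝ a penalty function. For θ ∈ Θ define l_P(θ) = log(∑_{z ∈ Z} p(θ)(z)) − P(θ), and for each θ define the posterior q_θ(z) = p(θ)(z) / ∑_{w ∈ Z} p(θ)(w). Suppose (θ_t)_{t ∈ ℕ} is a sequence such that for every t, θ_{t+1} maximizes over θ' the function ∑_{z ∈ Z} q_{θ_t}(z) · log(p(θ')(z)) − P(θ'). If the sequence (l_P(θ_t))_t is bounded above, then there exists a real constant l* such that lim_{t → ∞} l_P(θ_t) = l*. -/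

import Mathlib

/-- Jensen inequality for the logarithm: the posterior-weighted gain of the complete
log-likelihood is at most the gain of the marginal log-likelihood. -/
theorem sum_posterior_mul_log_sub_le {Z : Type*} [Fintype Z] [Nonempty Z] {a b : Z → ℝ}
    (ha : ∀ z, 0 < a z) (hb : ∀ z, 0 < b z) :
    ∑ z, (a z / ∑ w, a w) * Real.log (b z) - ∑ z, (a z / ∑ w, a w) * Real.log (a z) ≤
      Real.log (∑ z, b z) - Real.log (∑ z, a z) := by
  have hA : 0 < ∑ w, a w := Finset.sum_pos (fun z _ => ha z) Finset.univ_nonempty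
  have hB : 0 < ∑ w, b w := Finset.sum_pos (fun z _ => hb z) Finset.univ_nonempty
  set A := ∑ w, a w
  set B := ∑ w, b w
  have hsumA : ∑ z, a z / A = 1 := by rw [← Finset.sum_div, div_self hA.ne']
  have hsumB : ∑ z, b z / B = 1 := by rw [← Finset.sum_div, div_self hB.ne']
  have hterm : ∀ z, a z / A * Real.log (b z) - a z / A * Real.log (a z) ≤
      a z / A * (Real.log B - Real.log A) + (b z / B - a z / A) := by
    intro z
    have hα : 0 < a z / A := div_pos (ha z) hA
    have hβ : 0 < b z / B := div_pos (hb z) hB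
    have h := mul_le_mul_of_nonneg_left
      (Real.log_le_sub_one_of_pos (div_pos hβ hα)) hα.le
    rw [mul_sub, mul_div_cancel₀ _ hα.ne', Real.log_div hβ.ne' hα.ne',
      Real.log_div (hb z).ne' hB.ne', Real.log_div (ha z).ne' hA.ne'] at h
    linarith
  calc _ = ∑ z, (a z / A * Real.log (b z) - a z / A * Real.log (a z)) :=
        (Finset.sum_sub_distrib _ _).symm
    _ ≤ ∑ z, (a z / A * (Real.log B - Real.log A) + (b z / B - a z / A)) :=
        Finset.sum_le_sum fun z _ => hterm z
    _ = Real.log B - Real.log A := by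
        rw [Finset.sum_add_distrib, ← Finset.sum_mul, Finset.sum_sub_distrib, hsumA, hsumB]
        ring

/-- Theorem 1: convergence of the penalized log-likelihood values of the EM algorithm. -/
theorem penalized_em_convergence {Z Θ : Type*} [Fintype Z] [Nonempty Z]
    (p : Θ → Z → ℝ) (hp : ∀ θ z, 0 < p θ z) (P : Θ → ℝ) (θ : ℕ → Θ)
    (hstep : ∀ (t : ℕ) (θ' : Θ),
      ∑ z, (p (θ t) z / ∑ w, p (θ t) w) * Real.log (p θ' z) - P θ' ≤
      ∑ z, (p (θ t) z / ∑ w, p (θ t) w) * Real.log (p (θ (t + 1)) z) - P (θ (t + 1)))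
    (hbdd : ∃ M : ℝ, ∀ t : ℕ, Real.log (∑ z, p (θ t) z) - P (θ t) ≤ M) :
    ∃ lstar : ℝ,
      Filter.Tendsto (fun t : ℕ => Real.log (∑ z, p (θ t) z) - P (θ t))
        Filter.atTop (nhds lstar) := by
  obtain ⟨M, hM⟩ := hbdd
  refine ⟨_, tendsto_atTop_ciSup (monotone_nat_of_le_succ fun t => ?_)
    ⟨M, Set.forall_mem_range.2 hM⟩⟩
  linarith [hstep t (θ t), sum_posterior_mul_log_sub_le (hp (θ t)) (hp (θ (t + 1)))]
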